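/- arXiv:2210.10029 — 3 statements merged into one kernel-verified Lean document; each statement's English description precedes it below -/
import Mathlib

section
/- Let τ > 0 and δ > 0, and let N ⊆ ℝ be a measurable set. Then for every G in the Paley–Wiener space B¹(τ), one has ∫_N |G(x)| dx ≤ (80/13)·(τ + δ⁻¹) · (sup_{x∈ℝ} |N ∩ [x, x+δ]|) · ‖G‖_{L¹(ℝ)}, where |·| denotes Lebesgue measure. -/
open MeasureTheory Real Set FourierTransform

/-- The Paley–Wiener space `B¹(τ)`: integrable functions on `ℝ` whose (distributional)
Fourier transform — which for `L¹` functions is the continuous function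
`𝓕 G t = ∫ x, G x * exp (-2πixt)` — is supported in `[-τ, τ]`. -/
def PaleyWiener1 (τ : ℝ) (G : ℝ → ℂ) : Prop :=
  Integrable G ∧ ∀ t : ℝ, t ∉ Set.Icc (-τ) τ → 𝓕 G t = 0

open scoped ENNReal

theorem integral_fourier_mul_eq_flip {f g : ℝ → ℂ} (hf : Integrable f) (hg : Integrable g) :
    ∫ ξ, 𝓕 f ξ * g ξ = ∫ x, f x * 𝓕 g x := by
  simpa using! VectorFourier.integral_fourierIntegral_smul_eq_flip (L := innerₗ ℝ)
    Real.continuous_fourierChar continuous_inner hf hg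

theorem integral_fourierInv_mul_eq_flip {f g : ℝ → ℂ} (hf : Integrable f) (hg : Integrable g) :
    ∫ ξ, 𝓕⁻ f ξ * g ξ = ∫ x, f x * 𝓕⁻ g x := by
  have h := integral_fourier_mul_eq_flip hf hg.comp_neg
  rw [← integral_neg_eq_self] at h
  simpa only [Real.fourierInv_eq_fourier_neg f, Real.fourierInv_eq_fourier_comp_neg g, neg_neg]
    using h

/-- Fourier inversion almost everywhere, without any continuity assumption. -/
theorem MeasureTheory.Integrable.ae_eq_fourierInv_fourier {f : ℝ → ℂ} (hf : Integrable f)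
    (hf' : Integrable (𝓕 f)) : ∀ᵐ x, f x = 𝓕⁻ (𝓕 f) x := by
  have hcont : Continuous (𝓕⁻ (𝓕 f)) := by
    rw [Real.fourierInv_eq_fourier_comp_neg]
    exact VectorFourier.fourierIntegral_continuous (L := innerₗ ℝ) Real.continuous_fourierChar
      continuous_inner hf'.comp_neg
  refine ae_eq_of_integral_contDiff_smul_eq hf.locallyIntegrable hcont.locallyIntegrable ?_
  intro g hg hgs
  have hgs' : HasCompactSupport (fun x => (g x : ℂ)) := hgs.comp_left Complex.ofReal_zero
  let φ : SchwartzMap ℝ ℂ := hgs'.toSchwartzMap (Complex.ofRealCLM.contDiff.comp hg)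
  have hφ : ∀ x, φ x = g x := fun x => rfl
  let ψ : SchwartzMap ℝ ℂ := 𝓕⁻ φ
  have hψ : 𝓕 (ψ : ℝ → ℂ) = φ := by
    rw [← SchwartzMap.fourier_coe, FourierTransform.fourier_fourierInv_eq]
  have hψ' : (ψ : ℝ → ℂ) = 𝓕⁻ (φ : ℝ → ℂ) := SchwartzMap.fourierInv_coe φ
  have h1 := integral_fourier_mul_eq_flip hf ψ.integrable
  have h2 := integral_fourierInv_mul_eq_flip hf' φ.integrable
  rw [hψ] at h1
  rw [← hψ', h1] at h2
  simpa [Complex.real_smul, hφ, mul_comm] using h2.symm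

theorem fourier_mul_fourierChar (T : ℝ → ℂ) (x y : ℝ) :
    𝓕 (fun t => T t * (𝐞 (t * x) : ℂ)) y = 𝓕 T (y - x) := by
  simp only [Real.fourier_real_eq, Circle.smul_def, smul_eq_mul]
  congr 1
  ext t
  rw [show -(t * (y - x)) = -(t * y) + t * x by ring, AddChar.map_add_eq_mul]
  push_cast
  ring

theorem ae_eq_integral_mul_fourier_sub {G T : ℝ → ℂ} (hG : Integrable G) (hG' : Integrable (𝓕 G))
    (hT : Integrable T) (h : ∀ t, 𝓕 G t * T t = 𝓕 G t) :
    ∀ᵐ x, G x = ∫ y, G y * 𝓕 T (y - x) := by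
  filter_upwards [hG.ae_eq_fourierInv_fourier hG'] with x hx
  have hTx : Integrable (fun t => T t * (𝐞 (t * x) : ℂ)) := by
    refine hT.mul_bdd (c := 1) ?_ ?_
    · have : Continuous fun t : ℝ => (𝐞 (t * x) : ℂ) :=
        continuous_subtype_val.comp (Real.continuous_fourierChar.comp (by fun_prop))
      exact this.aestronglyMeasurable
    · exact .of_forall fun t => (Circle.norm_coe _).le
  have := integral_fourier_mul_eq_flip hG hTx
  simp only [fourier_mul_fourierChar] at this
  rw [← this, hx, Real.fourierInv_eq]
  congr 1
  ext t
  rw [← mul_assoc, h, Circle.smul_def, smul_eq_mul, mul_comm]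
  simp [mul_comm]

theorem integrable_fourier_of_support {τ : ℝ} {G : ℝ → ℂ} (hG : Integrable G)
    (h : ∀ t : ℝ, t ∉ Icc (-τ) τ → 𝓕 G t = 0) : Integrable (𝓕 G) := by
  have hcont : Continuous (𝓕 G) :=
    VectorFourier.fourierIntegral_continuous (L := innerₗ ℝ) Real.continuous_fourierChar
      continuous_inner hG
  exact hcont.integrable_of_hasCompactSupport (HasCompactSupport.intro isCompact_Icc h)

/-- The indicator function of the interval `[-a, a]`. -/
noncomputable def box (a : ℝ) : ℝ → ℂ := (Icc (-a) a).indicator 1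

theorem integrable_box (a : ℝ) : Integrable (box a) :=
  (integrable_indicator_iff measurableSet_Icc).2 (integrableOn_const (by simp))

theorem fourier_box_eq {a : ℝ} (ha : 0 ≤ a) (x : ℝ) :
    𝓕 (box a) x = ∫ t in (-a)..a, Complex.exp ((-2 * π * x * Complex.I) * t) := by
  rw [Real.fourier_real_eq_integral_exp_smul, intervalIntegral.integral_of_le (by linarith),
    ← integral_Icc_eq_integral_Ioc, ← integral_indicator measurableSet_Icc]
  congr 1
  ext t
  by_cases ht : t ∈ Icc (-a) a
  · simp only [box, indicator_of_mem ht, Pi.one_apply, smul_eq_mul, mul_one]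
    push_cast
    ring_nf
  · simp [box, indicator_of_notMem ht]

theorem norm_fourier_box_le {a : ℝ} (ha : 0 ≤ a) (x : ℝ) : ‖𝓕 (box a) x‖ ≤ 2 * a := by
  rw [fourier_box_eq ha]
  refine (intervalIntegral.norm_integral_le_of_norm_le_const (C := 1) ?_).trans ?_
  · intro t _
    rw [show (-2 * π * x * Complex.I) * t = ((-2 * π * x * t : ℝ) : ℂ) * Complex.I by
      push_cast; ring, Complex.norm_exp_ofReal_mul_I]
  · rw [one_mul, abs_of_nonneg (by linarith)]
    linarith

theorem abs_mul_norm_fourier_box_le {a : ℝ} (ha : 0 ≤ a) (x : ℝ) :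
    π * |x| * ‖𝓕 (box a) x‖ ≤ 1 := by
  rcases eq_or_ne x 0 with rfl | hx
  · simp
  have hc : (-2 * π * x * Complex.I : ℂ) ≠ 0 := by
    simp [hx, Real.pi_ne_zero]
  have hn : ‖(-2 * π * x * Complex.I : ℂ)‖ = 2 * π * |x| := by
    simp [abs_of_pos Real.pi_pos]
  have hexp (t : ℝ) : ‖Complex.exp ((-2 * π * x * Complex.I) * t)‖ = 1 := by
    rw [show (-2 * π * x * Complex.I) * t = ((-2 * π * x * t : ℝ) : ℂ) * Complex.I by
      push_cast; ring, Complex.norm_exp_ofReal_mul_I]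
  have hpos : 0 < π * |x| := by positivity
  rw [fourier_box_eq ha, integral_exp_mul_complex hc, norm_div, hn]
  have := norm_sub_le (Complex.exp ((-2 * π * x * Complex.I) * a))
    (Complex.exp ((-2 * π * x * Complex.I) * (-a : ℝ)))
  rw [hexp, hexp] at this
  rw [← mul_div_assoc, div_le_one (by positivity)]
  nlinarith

open ContinuousLinearMap Convolution in
/-- The trapezoidal function, equal to `1` on `[-τ, τ]` and supported in `[-2τ, 2τ]`. -/
noncomputable def trapezoid (τ : ℝ) : ℝ → ℂ :=
  (τ : ℂ)⁻¹ • (box (τ / 2) ⋆[ContinuousLinearMap.mul ℂ ℂ] box (3 * τ / 2))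

theorem integrable_trapezoid (τ : ℝ) : Integrable (trapezoid τ) :=
  ((integrable_box _).integrable_convolution _ (integrable_box _)).smul _

theorem fourier_trapezoid (τ x : ℝ) :
    𝓕 (trapezoid τ) x = (τ : ℂ)⁻¹ * (𝓕 (box (τ / 2)) x * 𝓕 (box (3 * τ / 2)) x) := by
  rw [← Real.fourier_mul_convolution_eq (integrable_box _) (integrable_box _)]
  simp only [trapezoid, Real.fourier_real_eq, Pi.smul_apply]
  rw [← integral_const_mul]
  simp only [smul_eq_mul, mul_smul_comm]

theorem trapezoid_eq_one {τ t : ℝ} (hτ : 0 < τ) (ht : t ∈ Icc (-τ) τ) : trapezoid τ t = 1 := by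
  have : ∀ s, box (τ / 2) s * box (3 * τ / 2) (t - s) = box (τ / 2) s := by
    intro s
    by_cases hs : s ∈ Icc (-(τ / 2)) (τ / 2)
    · have : t - s ∈ Icc (-(3 * τ / 2)) (3 * τ / 2) := by
        constructor <;> linarith [ht.1, ht.2, hs.1, hs.2]
      simp [box, indicator_of_mem this]
    · simp [box, indicator_of_notMem hs]
  simp only [trapezoid, Pi.smul_apply, convolution, ContinuousLinearMap.mul_apply', this]
  rw [box, integral_indicator measurableSet_Icc]
  have h : (τ : ℂ) ≠ 0 := by exact_mod_cast hτ.ne'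
  have h2 : τ / 2 + τ / 2 = τ := by ring
  simp [h, h2, hτ.le]

theorem norm_fourier_trapezoid_le {τ : ℝ} (hτ : 0 < τ) (x : ℝ) :
    ‖𝓕 (trapezoid τ) x‖ ≤ 6 * τ * (1 + (√3 * π * τ * x) ^ 2)⁻¹ := by
  rw [fourier_trapezoid, norm_mul, norm_mul, norm_inv, Complex.norm_real, norm_of_nonneg hτ.le]
  have h1 := norm_fourier_box_le (a := τ / 2) (by positivity) x
  have h2 := norm_fourier_box_le (a := 3 * τ / 2) (by positivity) x
  have h3 := abs_mul_norm_fourier_box_le (a := τ / 2) (by positivity) x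
  have h4 := abs_mul_norm_fourier_box_le (a := 3 * τ / 2) (by positivity) x
  set A := ‖𝓕 (box (τ / 2)) x‖
  set B := ‖𝓕 (box (3 * τ / 2)) x‖
  have hA : 0 ≤ A := norm_nonneg _
  have hB : 0 ≤ B := norm_nonneg _
  have h5 : A * B ≤ (2 * (τ / 2)) * (2 * (3 * τ / 2)) := mul_le_mul h1 h2 hB (by positivity)
  have h6 : (π * |x| * A) * (π * |x| * B) ≤ 1 * 1 := mul_le_mul h3 h4 (by positivity) (by simp)
  have h7 : (√3 * π * τ * x) ^ 2 = 3 * τ ^ 2 * (π * |x|) ^ 2 := by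
    rw [mul_pow, mul_pow, mul_pow, mul_pow, sq_abs, Real.sq_sqrt (by norm_num)]
    ring
  rw [h7, ← div_eq_mul_inv, le_div_iff₀ (by positivity), inv_mul_eq_div, div_mul_eq_mul_div,
    div_le_iff₀ hτ]
  nlinarith [mul_le_mul_of_nonneg_left h6 (sq_nonneg τ)]

theorem lintegral_comp_max_abs_sub_le {m : ℝ → ℝ≥0∞} (hm : Measurable m)
    (hanti : ∀ x y, |x| ≤ |y| → m y ≤ m x) {δ : ℝ} (hδ : 0 < δ) :
    ∫⁻ s, m (max (|s| - δ / 2) 0) ≤ ENNReal.ofReal δ * m 0 + ∫⁻ s, m s := by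
  have hle : ∀ s, m (max (|s| - δ / 2) 0) ≤ (Icc (-(δ / 2)) (δ / 2)).indicator (fun _ => m 0) s
      + ((Ioi 0).indicator m (s - δ / 2) + (Iio 0).indicator m (s + δ / 2)) := by
    intro s
    by_cases hs : s ∈ Icc (-(δ / 2)) (δ / 2)
    · rw [indicator_of_mem hs]
      exact (hanti _ _ (by simp)).trans le_self_add
    · rw [indicator_of_notMem hs, zero_add]
      have hs' : δ / 2 < |s| := by
        by_contra! h
        exact hs (abs_le.1 h)
      rcases lt_abs.1 hs' with h | h
      · rw [indicator_of_mem (show s - δ / 2 ∈ Ioi 0 by simpa using h)]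
        refine (hanti _ _ ?_).trans le_self_add
        rw [abs_of_pos (by linarith : 0 < s), max_eq_left (by linarith)]
      · rw [indicator_of_mem (show s + δ / 2 ∈ Iio 0 by simp only [mem_Iio]; linarith)]
        refine (hanti _ _ ?_).trans le_add_self
        rw [abs_of_neg (by linarith : s < 0), max_eq_left (by linarith), abs_of_neg (by linarith),
          abs_of_pos (by linarith)]
        linarith
  have hpos : Measurable ((Ioi 0).indicator m) := hm.indicator measurableSet_Ioi
  have hpos' : Measurable fun s => (Ioi 0).indicator m (s - δ / 2) :=
    hpos.comp (measurable_id.sub_const _)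
  refine (lintegral_mono hle).trans ?_
  rw [lintegral_add_left (measurable_const.indicator measurableSet_Icc),
    lintegral_add_left hpos',
    lintegral_sub_right_eq_self (fun s => (Ioi 0).indicator m s),
    lintegral_add_right_eq_self (fun s => (Iio 0).indicator m s),
    ← lintegral_add_left hpos, lintegral_indicator_const measurableSet_Icc, Real.volume_Icc,
    mul_comm]
  refine add_le_add (by rw [show δ / 2 - -(δ / 2) = δ by ring]) (lintegral_mono fun s => ?_)
  rcases lt_trichotomy s 0 with h | h | h
  · simp [h, h.le]
  · simp [h]
  · simp [h, h.le]

theorem setLIntegral_comp_sub_le_of_antitone_abs {m : ℝ → ℝ≥0∞} (hm : Measurable m)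
    (hanti : ∀ x y, |x| ≤ |y| → m y ≤ m x) {δ : ℝ} (hδ : 0 < δ) {N : Set ℝ}
    {p : ℝ≥0∞} (hp : ∀ x, volume (N ∩ Icc x (x + δ)) ≤ p) (y : ℝ) :
    ENNReal.ofReal δ * ∫⁻ x in N, m (y - x) ≤ p * (ENNReal.ofReal δ * m 0 + ∫⁻ s, m s) := by
  set M : ℝ → ℝ≥0∞ := fun s => m (max (|s| - δ / 2) 0)
  have hM : Measurable M := hm.comp (by fun_prop)
  let S : Set (ℝ × ℝ) := {q | |q.2 - q.1| ≤ δ / 2}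
  have hS : MeasurableSet S := measurableSet_le (by fun_prop) measurable_const
  let F : ℝ × ℝ → ℝ≥0∞ := S.indicator (fun q => M (y - q.2))
  have hF : Measurable F := (hM.comp (by fun_prop)).indicator hS
  have hmF : ∀ x, ENNReal.ofReal δ * m (y - x) ≤ ∫⁻ s, F (x, s) := by
    intro x
    calc ENNReal.ofReal δ * m (y - x)
        = ∫⁻ s, (Icc (x - δ / 2) (x + δ / 2)).indicator (fun _ => m (y - x)) s := by
          rw [lintegral_indicator_const measurableSet_Icc, Real.volume_Icc, mul_comm]
          ring_nf
      _ ≤ ∫⁻ s, F (x, s) := by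
          refine lintegral_mono (indicator_le' (fun s hs => ?_) (fun _ _ => zero_le))
          have hxs : |s - x| ≤ δ / 2 := abs_le.2 ⟨by linarith [hs.1], by linarith [hs.2]⟩
          rw [show F (x, s) = M (y - s) from indicator_of_mem (show (x, s) ∈ S from hxs) _]
          refine hanti _ _ ?_
          rw [abs_of_nonneg (le_max_right _ _)]
          refine max_le ?_ (abs_nonneg _)
          have h2 := abs_sub_abs_le_abs_sub (y - s) (y - x)
          rw [show y - s - (y - x) = -(s - x) by ring, abs_neg] at h2
          linarith
  have hFs : ∀ s, ∫⁻ x in N, F (x, s) ≤ p * M (y - s) := by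
    intro s
    have : ∀ x, F (x, s) = (Icc (s - δ / 2) (s + δ / 2)).indicator (fun _ => M (y - s)) x := by
      intro x
      have hiff : (x, s) ∈ S ↔ x ∈ Icc (s - δ / 2) (s + δ / 2) := by
        simp only [S, mem_ofPred_eq, abs_le, mem_Icc]
        constructor <;> rintro ⟨h1, h2⟩ <;> constructor <;> linarith
      by_cases h : x ∈ Icc (s - δ / 2) (s + δ / 2)
      · simp only [F, indicator_of_mem h, indicator_of_mem (hiff.2 h)]
      · simp only [F, indicator_of_notMem h, indicator_of_notMem (mt hiff.1 h)]
    simp only [this]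
    rw [lintegral_indicator_const measurableSet_Icc, Measure.restrict_apply measurableSet_Icc,
      mul_comm, inter_comm]
    gcongr
    have := hp (s - δ / 2)
    rwa [show s - δ / 2 + δ = s + δ / 2 by ring] at this
  calc ENNReal.ofReal δ * ∫⁻ x in N, m (y - x)
      = ∫⁻ x in N, ENNReal.ofReal δ * m (y - x) :=
        (lintegral_const_mul _ (hm.comp (by fun_prop))).symm
    _ ≤ ∫⁻ x in N, ∫⁻ s, F (x, s) := lintegral_mono hmF
    _ = ∫⁻ s, ∫⁻ x in N, F (x, s) := lintegral_lintegral_swap hF.aemeasurable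
    _ ≤ ∫⁻ s, p * M (y - s) := lintegral_mono hFs
    _ = p * ∫⁻ s, M s := by
        have hMy : Measurable fun s => M (y - s) := hM.comp (by fun_prop)
        rw [lintegral_const_mul _ hMy, lintegral_sub_left_eq_self]
    _ ≤ p * (ENNReal.ofReal δ * m 0 + ∫⁻ s, m s) := by
        gcongr
        exact lintegral_comp_max_abs_sub_le hm hanti hδ

theorem lintegral_inv_one_add_sq_mul {A c : ℝ} (hA : 0 ≤ A) (hc : 0 < c) :
    ∫⁻ x : ℝ, ENNReal.ofReal (A * (1 + (c * x) ^ 2)⁻¹) = ENNReal.ofReal (A * (π / c)) := by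
  have hint : Integrable fun x : ℝ => A * (1 + (c * x) ^ 2)⁻¹ :=
    (integrable_inv_one_add_sq.comp_mul_left' hc.ne').const_mul A
  rw [← ofReal_integral_eq_lintegral_ofReal hint (.of_forall fun x => by positivity),
    integral_const_mul, Measure.integral_comp_mul_left (fun x => (1 + x ^ 2)⁻¹) c,
    integral_univ_inv_one_add_sq, abs_of_pos (inv_pos.2 hc), smul_eq_mul, inv_mul_eq_div]

/-- If `f` is dominated by its convolution with a radially decreasing kernel `m`, then the mass of
`f` on `N` is controlled by the maximal measure of `N` in intervals of length `δ`. -/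
theorem ofReal_mul_setLIntegral_le {m : ℝ → ℝ≥0∞} (hm : Measurable m)
    (hanti : ∀ x y, |x| ≤ |y| → m y ≤ m x) {δ : ℝ} (hδ : 0 < δ) {N : Set ℝ}
    {p : ℝ≥0∞} (hp : ∀ x, volume (N ∩ Icc x (x + δ)) ≤ p)
    {f : ℝ → ℝ≥0∞} (hf : AEMeasurable f) (hfm : ∀ᵐ x, f x ≤ ∫⁻ y, f y * m (y - x)) :
    ENNReal.ofReal δ * ∫⁻ x in N, f x
      ≤ p * (ENNReal.ofReal δ * m 0 + ∫⁻ s, m s) * ∫⁻ x, f x := by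
  calc ENNReal.ofReal δ * ∫⁻ x in N, f x
      ≤ ENNReal.ofReal δ * ∫⁻ x in N, ∫⁻ y, f y * m (y - x) := by
        exact mul_le_mul_right (lintegral_mono_ae (ae_restrict_of_ae hfm)) _
    _ = ENNReal.ofReal δ * ∫⁻ y, ∫⁻ x in N, f y * m (y - x) := by
        rw [lintegral_lintegral_swap]
        exact hf.comp_snd.mul (hm.comp (by fun_prop)).aemeasurable
    _ = ∫⁻ y, f y * (ENNReal.ofReal δ * ∫⁻ x in N, m (y - x)) := by
        rw [← lintegral_const_mul' _ _ ENNReal.ofReal_ne_top]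
        congr 1
        ext y
        have hmy : Measurable fun x => m (y - x) := hm.comp (by fun_prop)
        rw [lintegral_const_mul _ hmy, mul_left_comm]
    _ ≤ ∫⁻ y, f y * (p * (ENNReal.ofReal δ * m 0 + ∫⁻ s, m s)) := by
        refine lintegral_mono fun y => mul_le_mul_right ?_ _
        exact setLIntegral_comp_sub_le_of_antitone_abs hm hanti hδ hp y
    _ = p * (ENNReal.ofReal δ * m 0 + ∫⁻ s, m s) * ∫⁻ x, f x := by
        rw [lintegral_mul_const'' _ hf, mul_comm]

theorem volume_inter_Icc_le_ofReal_iSup (N : Set ℝ) (δ x : ℝ) :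
    volume (N ∩ Icc x (x + δ))
      ≤ ENNReal.ofReal (⨆ x : ℝ, (volume (N ∩ Icc x (x + δ))).toReal) := by
  have hle : ∀ x, volume (N ∩ Icc x (x + δ)) ≤ ENNReal.ofReal δ := fun x => by
    simpa using measure_mono (μ := volume) (inter_subset_right (s := N) (t := Icc x (x + δ)))
  refine ENNReal.le_ofReal_iff_toReal_le ((hle x).trans_lt ENNReal.ofReal_lt_top).ne ?_ |>.2 ?_
  · exact Real.iSup_nonneg fun _ => ENNReal.toReal_nonneg
  · refine le_ciSup (f := fun x : ℝ => (volume (N ∩ Icc x (x + δ))).toReal) ?_ x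
    refine ⟨(ENNReal.ofReal δ).toReal, ?_⟩
    rintro _ ⟨x, rfl⟩
    exact ENNReal.toReal_mono ENNReal.ofReal_ne_top (hle x)

theorem PaleyWiener1.ae_enorm_le {τ : ℝ} (hτ : 0 < τ) {G : ℝ → ℂ} (hG : PaleyWiener1 τ G) :
    ∀ᵐ x, ‖G x‖ₑ ≤ ∫⁻ y, ‖G y‖ₑ *
      ENNReal.ofReal (6 * τ * (1 + (√3 * π * τ * (y - x)) ^ 2)⁻¹) := by
  have hmul : ∀ t, 𝓕 G t * trapezoid τ t = 𝓕 G t := fun t => by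
    by_cases ht : t ∈ Icc (-τ) τ
    · rw [trapezoid_eq_one hτ ht, mul_one]
    · rw [hG.2 t ht, zero_mul]
  filter_upwards [ae_eq_integral_mul_fourier_sub hG.1
    (integrable_fourier_of_support hG.1 hG.2) (integrable_trapezoid τ) hmul] with x hx
  rw [hx]
  refine (enorm_integral_le_lintegral_enorm _).trans (lintegral_mono fun y => ?_)
  rw [enorm_mul]
  refine mul_le_mul_right ?_ _
  rw [← ofReal_norm]
  exact ENNReal.ofReal_le_ofReal (norm_fourier_trapezoid_le hτ _)

theorem donoho_logan_all_densities (τ δ : ℝ) (hτ : 0 < τ) (hδ : 0 < δ)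
    (N : Set ℝ) (hN : MeasurableSet N) (G : ℝ → ℂ) (hG : PaleyWiener1 τ G) :
    ∫ x in N, ‖G x‖ ≤ (80 / 13) * (τ + δ⁻¹) *
      (⨆ x : ℝ, (volume (N ∩ Set.Icc x (x + δ))).toReal) * ∫ x : ℝ, ‖G x‖ := by
  set P := ⨆ x : ℝ, (volume (N ∩ Set.Icc x (x + δ))).toReal
  have hP : 0 ≤ P := Real.iSup_nonneg fun _ => ENNReal.toReal_nonneg
  set c := √3 * π * τ with hc
  have hcpos : 0 < c := by positivity
  let m : ℝ → ℝ≥0∞ := fun x => ENNReal.ofReal (6 * τ * (1 + (c * x) ^ 2)⁻¹)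
  have hm : Measurable m := by fun_prop
  have hanti : ∀ x y, |x| ≤ |y| → m y ≤ m x := fun x y hxy => by
    have : (c * x) ^ 2 ≤ (c * y) ^ 2 := by
      rw [sq_le_sq, abs_mul c x, abs_mul c y]
      exact mul_le_mul_of_nonneg_left hxy (abs_nonneg c)
    refine ENNReal.ofReal_le_ofReal ?_
    gcongr
  have hm0 : m 0 = ENNReal.ofReal (6 * τ) := by simp [m]
  have key := ofReal_mul_setLIntegral_le hm hanti hδ (volume_inter_Icc_le_ofReal_iSup N δ)
    hG.1.aestronglyMeasurable.enorm (hG.ae_enorm_le hτ)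
  rw [hm0, lintegral_inv_one_add_sq_mul (by positivity) hcpos,
    ← ofReal_integral_norm_eq_lintegral_enorm hG.1,
    ← ofReal_integral_norm_eq_lintegral_enorm hG.1.restrict, ← ENNReal.ofReal_mul hδ.le,
    ← ENNReal.ofReal_mul hδ.le, ← ENNReal.ofReal_add (by positivity) (by positivity),
    ← ENNReal.ofReal_mul hP, ← ENNReal.ofReal_mul (by positivity),
    ENNReal.ofReal_le_ofReal_iff (by positivity)] at key
  have hconst : 6 * τ * (π / c) ≤ 80 / 13 := by
    have h3 : (1.7 : ℝ) ≤ √3 := Real.le_sqrt_of_sq_le (by norm_num)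
    have : 6 * τ * (π / c) = 6 / √3 := by
      rw [hc]
      field_simp
    rw [this, div_le_iff₀ (by positivity)]
    linarith
  have hJ : 0 ≤ ∫ x : ℝ, ‖G x‖ := by positivity
  refine le_of_mul_le_mul_left (key.trans ?_) hδ
  calc P * (δ * (6 * τ) + 6 * τ * (π / c)) * ∫ x : ℝ, ‖G x‖
      ≤ P * (δ * (80 / 13 * τ) + 80 / 13) * ∫ x : ℝ, ‖G x‖ := by
        gcongr
        norm_num
    _ = δ * (80 / 13 * (τ + δ⁻¹) * P * ∫ x : ℝ, ‖G x‖) := by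
        field_simp
end

section
/- For every ε > 0 there exists M > 0 such that for all τ > 0 and δ > 0 with τδ ≥ M and every measurable set N ⊆ ℝ, one has for all G in the Paley–Wiener space B¹(τ): ∫_N |G(x)| dx ≤ (2 + ε)·(τ + δ⁻¹) · (sup_{x∈ℝ} |N ∩ [x, x+δ]|) · ‖G‖_{L¹(ℝ)}. -/
open MeasureTheory Real Set FourierTransform

open scoped SchwartzMap ContDiff Convolution ENNReal

/-- An integrable function on `ℝ` whose Fourier transform vanishes is zero almost everywhere. -/
theorem ae_eq_zero_of_fourier_eq_zero {f : ℝ → ℂ} (hf : Integrable f) (h : ∀ t, 𝓕 f t = 0) :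
    ∀ᵐ x, f x = 0 := by
  refine ae_eq_zero_of_integral_contDiff_smul_eq_zero hf.locallyIntegrable fun g hg hgc => ?_
  have hgc' : HasCompactSupport fun x => (g x : ℂ) :=
    hgc.comp_left (g := fun r : ℝ => (r : ℂ)) Complex.ofReal_zero
  have hg' : ContDiff ℝ ∞ fun x => (g x : ℂ) := Complex.ofRealCLM.contDiff.comp hg
  let ψ : 𝓢(ℝ, ℂ) := hgc'.toSchwartzMap hg'
  let η : 𝓢(ℝ, ℂ) := 𝓕⁻ ψ
  have hη : ∀ x, 𝓕 (η : ℝ → ℂ) x = (g x : ℂ) := fun x => by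
    rw [← SchwartzMap.fourier_coe, FourierTransform.fourier_fourierInv_eq]
    rfl
  have key : ∫ x, 𝓕 (η : ℝ → ℂ) x • f x = ∫ x, η x • 𝓕 f x := by
    simpa using! VectorFourier.integral_fourierIntegral_smul_eq_flip (L := innerₗ ℝ)
      Real.continuous_fourierChar continuous_inner η.integrable hf
  simpa [hη, h] using key

/-- A smooth substitute for the de la Vallée-Poussin kernel. -/
theorem exists_schwartz_fourier_eq_one {ε : ℝ} (hε : 0 < ε) :
    ∃ K : 𝓢(ℝ, ℂ), (∀ t ∈ Icc (-1 : ℝ) 1, 𝓕 (K : ℝ → ℂ) t = 1) ∧ ∀ x, ‖K x‖ ≤ 2 + ε := by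
  let b : ContDiffBump (0 : ℝ) := ⟨1, 1 + ε / 2, one_pos, by linarith⟩
  have hbc : HasCompactSupport fun x => (b x : ℂ) :=
    b.hasCompactSupport.comp_left (g := fun r : ℝ => (r : ℂ)) Complex.ofReal_zero
  have hb : ContDiff ℝ ∞ fun x => (b x : ℂ) := Complex.ofRealCLM.contDiff.comp b.contDiff
  let φ : 𝓢(ℝ, ℂ) := hbc.toSchwartzMap hb
  have hφ : ∀ x, φ x = (b x : ℂ) := fun x => rfl
  refine ⟨𝓕⁻ φ, fun t ht => ?_, fun x => ?_⟩
  · rw [← SchwartzMap.fourier_coe, FourierTransform.fourier_fourierInv_eq, hφ,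
      b.one_of_mem_closedBall, Complex.ofReal_one]
    simpa [abs_le] using ht
  · have hint : ∫ v, ‖φ v‖ ≤ 2 + ε := by
      calc ∫ v, ‖φ v‖ = ∫ v, b v := by
            simp only [hφ, Complex.norm_real, Real.norm_of_nonneg b.nonneg]
        _ ≤ volume.real (Metric.closedBall (0 : ℝ) b.rOut) := b.integral_le_measure_closedBall volume
        _ = 2 + ε := by
            rw [Real.volume_real_closedBall b.rOut_pos.le]
            change 2 * (1 + ε / 2) = 2 + ε
            ring
    rw [SchwartzMap.fourierInv_coe, Real.fourierInv_eq]
    refine (norm_integral_le_integral_norm _).trans (le_of_eq_of_le ?_ hint)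
    simp only [Circle.norm_smul]

theorem fourier_dilation {τ : ℝ} (hτ : 0 < τ) (f : ℝ → ℂ) (t : ℝ) :
    𝓕 (fun x => (τ : ℂ) * f (τ * x)) t = 𝓕 f (t / τ) := by
  rw [Real.fourier_real_eq, Real.fourier_real_eq]
  have h := Measure.integral_comp_mul_left (fun v : ℝ => 𝐞 (-(v * (t / τ))) • f v) τ
  have e : ∀ x : ℝ, 𝐞 (-(x * t)) • ((τ : ℂ) * f (τ * x)) =
      (τ : ℂ) * (𝐞 (-(τ * x * (t / τ))) • f (τ * x)) := fun x => by
    rw [mul_smul_comm, show τ * x * (t / τ) = x * t by field_simp]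
  simp only [e]
  rw [integral_const_mul, h, abs_of_pos (inv_pos.2 hτ), Complex.real_smul, ← mul_assoc,
    ← Complex.ofReal_mul, mul_inv_cancel₀ hτ.ne', Complex.ofReal_one, one_mul]

/-- A kernel whose Fourier transform is `1` on `[-τ, τ]` reproduces `B¹(τ)`. -/
theorem PaleyWiener1.ae_eq_convolution {τ : ℝ} {G k : ℝ → ℂ} (hG : PaleyWiener1 τ G)
    (hk : Integrable k) (hk1 : ∀ t ∈ Icc (-τ) τ, 𝓕 k t = 1) :
    ∀ᵐ x, G x = ∫ y, G y * k (x - y) := by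
  have hc : Integrable (G ⋆[ContinuousLinearMap.mul ℂ ℂ] k) := hG.1.integrable_convolution _ hk
  have h := ae_eq_zero_of_fourier_eq_zero (hG.1.sub hc) fun t => by
    have hsub : 𝓕 (G - G ⋆[ContinuousLinearMap.mul ℂ ℂ] k) t =
        𝓕 G t - 𝓕 (G ⋆[ContinuousLinearMap.mul ℂ ℂ] k) t := by
      simp only [Real.fourier_eq, Pi.sub_apply, smul_sub]
      exact integral_sub ((Real.fourierIntegral_convergent_iff t).2 hG.1)
        ((Real.fourierIntegral_convergent_iff t).2 hc)
    rw [hsub, Real.fourier_mul_convolution_eq hG.1 hk]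
    by_cases ht : t ∈ Icc (-τ) τ
    · rw [hk1 t ht, mul_one, sub_self]
    · rw [hG.2 t ht, zero_mul, sub_self]
  filter_upwards [h] with x hx
  exact sub_eq_zero.1 hx

/-- Schur-type estimate for functions reproduced by a convolution kernel. -/
theorem setIntegral_norm_le_of_ae_eq_convolution {G k : ℝ → ℂ} (hG : Integrable G)
    (hk : Continuous k) (h : ∀ᵐ x, G x = ∫ y, G y * k (x - y)) {N : Set ℝ} {B : ℝ} (hB : 0 ≤ B)
    (hN : ∀ y, ∫⁻ x in N, ‖k (x - y)‖ₑ ≤ ENNReal.ofReal B) :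
    ∫ x in N, ‖G x‖ ≤ B * ∫ x, ‖G x‖ := by
  have key : ∫⁻ x in N, ‖G x‖ₑ ≤ ENNReal.ofReal B * ∫⁻ y, ‖G y‖ₑ := by
    calc ∫⁻ x in N, ‖G x‖ₑ ≤ ∫⁻ x in N, ∫⁻ y, ‖G y‖ₑ * ‖k (x - y)‖ₑ := by
          refine lintegral_mono_ae ((ae_restrict_of_ae h).mono fun x hx => ?_)
          rw [hx]
          simpa only [enorm_mul] using enorm_integral_le_lintegral_enorm fun y => G y * k (x - y)
      _ = ∫⁻ y, ∫⁻ x in N, ‖G y‖ₑ * ‖k (x - y)‖ₑ := by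
          have hGm : AEMeasurable (fun p : ℝ × ℝ => ‖G p.2‖ₑ) ((volume.restrict N).prod volume) :=
            hG.1.enorm.comp_snd
          have hkm : Continuous fun p : ℝ × ℝ => k (p.1 - p.2) := by fun_prop
          exact lintegral_lintegral_swap (hGm.mul hkm.enorm.measurable.aemeasurable)
      _ = ∫⁻ y, ‖G y‖ₑ * ∫⁻ x in N, ‖k (x - y)‖ₑ := by
          refine lintegral_congr fun y => lintegral_const_mul' _ _ enorm_ne_top
      _ ≤ ∫⁻ y, ‖G y‖ₑ * ENNReal.ofReal B := lintegral_mono fun y => by gcongr; exact hN y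
      _ = ENNReal.ofReal B * ∫⁻ y, ‖G y‖ₑ := by
          rw [lintegral_mul_const' _ _ ENNReal.ofReal_ne_top, mul_comm]
  rw [integral_norm_eq_lintegral_enorm hG.1.restrict, integral_norm_eq_lintegral_enorm hG.1,
    ← ENNReal.toReal_ofReal hB, ← ENNReal.toReal_mul]
  exact ENNReal.toReal_mono (ENNReal.mul_ne_top ENNReal.ofReal_ne_top hG.2.ne) key

theorem volume_inter_Icc_le_iSup {δ : ℝ} (N : Set ℝ) (x : ℝ) :
    volume (N ∩ Icc x (x + δ)) ≤
      ENNReal.ofReal (⨆ x : ℝ, (volume (N ∩ Icc x (x + δ))).toReal) := by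
  have hle : ∀ x : ℝ, volume (N ∩ Icc x (x + δ)) ≤ ENNReal.ofReal δ := fun x =>
    (measure_mono inter_subset_right).trans (by simp [Real.volume_Icc])
  have hne : ∀ x : ℝ, volume (N ∩ Icc x (x + δ)) ≠ ⊤ := fun x =>
    ((hle x).trans_lt ENNReal.ofReal_lt_top).ne
  rw [ENNReal.le_ofReal_iff_toReal_le (hne x) (Real.iSup_nonneg fun _ => ENNReal.toReal_nonneg)]
  refine le_ciSup (f := fun x : ℝ => (volume (N ∩ Icc x (x + δ))).toReal)
    ⟨(ENNReal.ofReal δ).toReal, ?_⟩ x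
  rintro _ ⟨y, rfl⟩
  exact ENNReal.toReal_mono ENNReal.ofReal_ne_top (hle y)

/-- A bounded kernel with quadratic decay, integrated over a set whose mass in every interval of
length `δ` is controlled. -/
theorem lintegral_enorm_translate_le {k : ℝ → ℂ} {A C δ : ℝ} (hδ : 0 < δ) (hA : ∀ x, ‖k x‖ ≤ A)
    (hC : ∀ x, x ^ 2 * ‖k x‖ ≤ C) (N : Set ℝ) (y : ℝ) :
    ∫⁻ x in N, ‖k (x - y)‖ₑ ≤ ENNReal.ofReal ((A + 4 * C / δ ^ 2 * ∑' j : ℤ, 1 / (j : ℝ) ^ 2) *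
      ⨆ x : ℝ, (volume (N ∩ Icc x (x + δ))).toReal) := by
  set S := ⨆ x : ℝ, (volume (N ∩ Icc x (x + δ))).toReal
  have hA0 : 0 ≤ A := (norm_nonneg _).trans (hA 0)
  have hC0 : 0 ≤ C := by simpa using hC 0
  let I : ℤ → Set ℝ := fun j => Icc (y - δ / 2 + j * δ) (y - δ / 2 + j * δ + δ)
  let b : ℤ → ℝ := fun j => Pi.single (M := fun _ => ℝ) 0 A j + 4 * C / δ ^ 2 * (1 / (j : ℝ) ^ 2)
  have hb : HasSum b (A + 4 * C / δ ^ 2 * ∑' j : ℤ, 1 / (j : ℝ) ^ 2) :=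
    (hasSum_pi_single 0 A).add
      (((Real.summable_one_div_int_pow (p := 2)).2 one_lt_two).hasSum.mul_left _)
  have hb0 : ∀ j, 0 ≤ b j := fun j =>
    add_nonneg (Pi.single_nonneg (α := fun _ : ℤ => ℝ).2 hA0 j) (by positivity)
  have hkb : ∀ j, ∀ x ∈ I j, ‖k (x - y)‖ ≤ b j := by
    intro j x hx
    obtain rfl | hj := eq_or_ne j 0
    · simpa [b] using hA (x - y)
    have hj1 : (1 : ℝ) ≤ |(j : ℝ)| := by exact_mod_cast Int.one_le_abs hj
    have hxy : |(j : ℝ)| * δ / 2 ≤ |x - y| := by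
      obtain ⟨h1, h2⟩ := hx
      rcases abs_cases (j : ℝ) with ⟨h, _⟩ | ⟨h, _⟩
      · rw [h] at hj1 ⊢
        exact le_abs.2 (Or.inl (by nlinarith))
      · rw [h] at hj1 ⊢
        exact le_abs.2 (Or.inr (by nlinarith))
    have hsq : (j : ℝ) ^ 2 * δ ^ 2 / 4 ≤ (x - y) ^ 2 := by
      have := pow_le_pow_left₀ (by positivity) hxy 2
      rw [sq_abs, div_pow, mul_pow, sq_abs] at this
      linarith
    have hj2 : (0 : ℝ) < (j : ℝ) ^ 2 := by positivity
    have h3 : (j : ℝ) ^ 2 * δ ^ 2 / 4 * ‖k (x - y)‖ ≤ C :=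
      (mul_le_mul_of_nonneg_right hsq (norm_nonneg _)).trans (hC _)
    have h4 : ‖k (x - y)‖ ≤ C / ((j : ℝ) ^ 2 * δ ^ 2 / 4) := by
      rw [le_div_iff₀ (by positivity)]
      linarith
    refine h4.trans_eq ?_
    simp only [b, Pi.single_eq_of_ne hj]
    field_simp
    ring
  have hcover : N ⊆ ⋃ j, N ∩ I j := by
    intro x hx
    obtain ⟨j, hj, -⟩ := existsUnique_sub_zsmul_mem_Ico hδ x (y - δ / 2)
    rw [zsmul_eq_mul] at hj
    exact mem_iUnion.2 ⟨j, hx, by linarith [hj.1], by linarith [hj.2]⟩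
  calc ∫⁻ x in N, ‖k (x - y)‖ₑ
      ≤ ∫⁻ x in ⋃ j, N ∩ I j, ‖k (x - y)‖ₑ := lintegral_mono_set hcover
    _ ≤ ∑' j, ∫⁻ x in N ∩ I j, ‖k (x - y)‖ₑ := lintegral_iUnion_le _ _
    _ ≤ ∑' j, ENNReal.ofReal (b j * S) := by
        refine ENNReal.tsum_le_tsum fun j => ?_
        calc ∫⁻ x in N ∩ I j, ‖k (x - y)‖ₑ
            ≤ ∫⁻ _ in N ∩ I j, ENNReal.ofReal (b j) := by
              refine setLIntegral_mono measurable_const fun x hx => ?_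
              rw [← ofReal_norm]
              exact ENNReal.ofReal_le_ofReal (hkb j x hx.2)
          _ = ENNReal.ofReal (b j) * volume (N ∩ I j) := setLIntegral_const _ _
          _ ≤ ENNReal.ofReal (b j) * ENNReal.ofReal S := by
              gcongr
              exact volume_inter_Icc_le_iSup N _
          _ = ENNReal.ofReal (b j * S) := (ENNReal.ofReal_mul (hb0 j)).symm
    _ = _ := by
        have hS : 0 ≤ S := Real.iSup_nonneg fun _ => ENNReal.toReal_nonneg
        rw [← ENNReal.ofReal_tsum_of_nonneg (fun j => mul_nonneg (hb0 j) hS)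
          (hb.mul_right S).summable, (hb.mul_right S).tsum_eq]

theorem donoho_logan_asymptotic (ε : ℝ) (hε : 0 < ε) :
    ∃ M : ℝ, 0 < M ∧ ∀ τ δ : ℝ, 0 < τ → 0 < δ → M ≤ τ * δ →
      ∀ N : Set ℝ, MeasurableSet N → ∀ G : ℝ → ℂ, PaleyWiener1 τ G →
        ∫ x in N, ‖G x‖ ≤ (2 + ε) * (τ + δ⁻¹) *
          (⨆ x : ℝ, (volume (N ∩ Set.Icc x (x + δ))).toReal) * ∫ x : ℝ, ‖G x‖ := by
  obtain ⟨K, hK1, hKA⟩ := exists_schwartz_fourier_eq_one (half_pos hε)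
  obtain ⟨C, hC, hKC⟩ := K.decay 2 0
  have hKC' : ∀ x, x ^ 2 * ‖K x‖ ≤ C := fun x => by simpa using hKC x
  set Z := ∑' j : ℤ, 1 / (j : ℝ) ^ 2
  have hZ : 0 ≤ Z := tsum_nonneg fun j => by positivity
  refine ⟨8 * C * Z / ε + 1, by positivity, fun τ δ hτ hδ hM N _ G hG => ?_⟩
  let k : ℝ → ℂ := fun x => (τ : ℂ) * K (τ * x)
  have hkn : ∀ x, ‖k x‖ = τ * ‖K (τ * x)‖ := fun x => by
    simp only [k, norm_mul, Complex.norm_real, Real.norm_of_nonneg hτ.le]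
  have hki : Integrable k := (K.integrable.comp_mul_left' hτ.ne').const_mul _
  have hkc : Continuous k := by
    have := K.continuous
    fun_prop
  have hk1 : ∀ t ∈ Icc (-τ) τ, 𝓕 k t = 1 := fun t ht => by
    rw [fourier_dilation hτ]
    exact hK1 _ ⟨by rw [le_div_iff₀ hτ]; linarith [ht.1], by rw [div_le_iff₀ hτ]; linarith [ht.2]⟩
  have hkA : ∀ x, ‖k x‖ ≤ τ * (2 + ε / 2) := fun x => by
    rw [hkn]
    exact mul_le_mul_of_nonneg_left (hKA _) hτ.le
  have hkC : ∀ x, x ^ 2 * ‖k x‖ ≤ C / τ := fun x => by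
    rw [hkn, le_div_iff₀ hτ]
    linarith [hKC' (τ * x), show x ^ 2 * (τ * ‖K (τ * x)‖) * τ = (τ * x) ^ 2 * ‖K (τ * x)‖ by ring]
  have hconst : τ * (2 + ε / 2) + 4 * (C / τ) / δ ^ 2 * Z ≤ (2 + ε) * (τ + δ⁻¹) := by
    have h1 : 8 * C * Z ≤ ε * (τ * δ) ^ 2 := by
      have h0 : 0 ≤ 8 * C * Z / ε := by positivity
      have h2 : 8 * C * Z / ε ≤ (τ * δ) ^ 2 := by nlinarith
      rw [div_le_iff₀ hε] at h2
      linarith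
    have h3 : 4 * (C / τ) / δ ^ 2 * Z ≤ τ * (ε / 2) := by
      rw [show 4 * (C / τ) / δ ^ 2 * Z = 4 * C * Z / (τ * δ ^ 2) by field_simp,
        div_le_iff₀ (by positivity)]
      linarith [show τ * (ε / 2) * (τ * δ ^ 2) = ε * (τ * δ) ^ 2 / 2 by ring]
    have h4 : 0 ≤ (2 + ε) * δ⁻¹ := by positivity
    linarith
  have hS : 0 ≤ ⨆ x : ℝ, (volume (N ∩ Set.Icc x (x + δ))).toReal :=
    Real.iSup_nonneg fun _ => ENNReal.toReal_nonneg
  refine setIntegral_norm_le_of_ae_eq_convolution hG.1 hkc (hG.ae_eq_convolution hki hk1)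
    (by positivity) fun y => (lintegral_enorm_translate_le hδ hkA hkC N y).trans ?_
  exact ENNReal.ofReal_le_ofReal (mul_le_mul_of_nonneg_right hconst hS)
end

section
/- Let a > 0 and let h : ℝ → ℝ be an even function that is positive and convex on the interval [-a, a]. Then for every integer n, (-1)^n ∫_{-a}^{a} h(t) cos(πnt/a) dt ≥ 0; that is, the Fourier coefficients of h over [-a,a] alternate in sign with the parity of n. -/
open MeasureTheory Real Set intervalIntegral

lemma ConvexOn.mul_cos_le_affine_mul_cos {r : ℝ} (hr : 0 < r) {g : ℝ → ℝ}
    (hg : ConvexOn ℝ (Icc (-r) r) g) {t : ℝ} (ht : t ∈ Icc (-r) r) :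
    g t * cos (π * t / r) ≤ ((g (r / 2) + g (-(r / 2))) / 2) * cos (π * t / r) +
      (g (r / 2) - g (-(r / 2))) / r * (t * cos (π * t / r)) := by
  obtain ⟨h1, h2⟩ := ht
  have hmem : r / 2 ∈ Icc (-r) r := ⟨by linarith, by linarith⟩
  have hmem' : -(r / 2) ∈ Icc (-r) r := ⟨by linarith, by linarith⟩
  have hπ := pi_pos
  have key : (g t - ((g (r / 2) + g (-(r / 2))) / 2 + (g (r / 2) - g (-(r / 2))) / r * t)) *
      cos (π * t / r) ≤ 0 := by
    have harg : π * t / r = π * (t / r) := by ring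
    have hlo : -1 ≤ t / r := by rw [le_div_iff₀ hr]; linarith
    have hhi : t / r ≤ 1 := by rw [div_le_iff₀ hr]; linarith
    have hB : (g (r / 2) - g (-(r / 2))) / r * t * r = (g (r / 2) - g (-(r / 2))) * t := by
      field_simp
    rcases lt_or_ge (r / 2) t with h | h
    · have hq : 1 / 2 < t / r := by rw [lt_div_iff₀ hr]; linarith
      apply mul_nonpos_of_nonneg_of_nonpos
      · have := hg.slope_mono_adjacent hmem' ⟨h1, h2⟩ (by linarith : -(r / 2) < r / 2) h
        rw [div_le_div_iff₀ (by linarith) (by linarith)] at this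
        rw [← mul_nonneg_iff_of_pos_right hr]
        linarith
      · rw [harg]
        apply cos_nonpos_of_pi_div_two_le_of_le <;> nlinarith
    rcases lt_or_ge t (-(r / 2)) with h' | h'
    · have hq : t / r < -(1 / 2) := by rw [div_lt_iff₀ hr]; linarith
      apply mul_nonpos_of_nonneg_of_nonpos
      · have := hg.slope_mono_adjacent ⟨h1, h2⟩ hmem h' (by linarith : -(r / 2) < r / 2)
        rw [div_le_div_iff₀ (by linarith) (by linarith)] at this
        rw [← mul_nonneg_iff_of_pos_right hr]
        linarith
      · rw [harg, ← cos_neg]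
        apply cos_nonpos_of_pi_div_two_le_of_le <;> nlinarith
    · have hq : -(1 / 2) ≤ t / r := by rw [le_div_iff₀ hr]; linarith
      have hq' : t / r ≤ 1 / 2 := by rw [div_le_iff₀ hr]; linarith
      apply mul_nonpos_of_nonpos_of_nonneg
      · have := hg.2 hmem hmem' (by linarith : 0 ≤ 1 / 2 + t / r)
          (by linarith : 0 ≤ 1 / 2 - t / r) (by ring)
        simp only [smul_eq_mul] at this
        have e : (1 / 2 + t / r) * (r / 2) + (1 / 2 - t / r) * -(r / 2) = t := by
          field_simp; ring
        rw [e] at this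
        have e2 : (g (r / 2) - g (-(r / 2))) / r * t = (g (r / 2) - g (-(r / 2))) * (t / r) := by
          ring
        rw [e2]
        linarith
      · rw [harg]
        apply cos_nonneg_of_neg_pi_div_two_le_of_le <;> nlinarith
  linarith

lemma ConvexOn.integral_mul_cos_nonpos {r : ℝ} (hr : 0 < r) {g : ℝ → ℝ}
    (hg : ConvexOn ℝ (Icc (-r) r) g) (hint : IntervalIntegrable g volume (-r) r) :
    ∫ t in (-r)..r, g t * cos (π * t / r) ≤ 0 := by
  have hcos : ∫ t in (-r)..r, cos (π * t / r) = 0 := by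
    have : ∀ t, π * t / r = π / r * t := fun t => by ring
    simp_rw [this]
    rw [intervalIntegral.integral_comp_mul_left _ (by positivity), integral_cos]
    simp [hr.ne']
  have hid : ∫ t in (-r)..r, t * cos (π * t / r) = 0 := by
    have h := intervalIntegral.integral_comp_neg (a := -r) (b := r)
      (fun t => t * cos (π * t / r))
    have e : ∀ t, -t * cos (π * -t / r) = -(t * cos (π * t / r)) := fun t => by
      rw [show π * -t / r = -(π * t / r) by ring, cos_neg]; ring
    simp only [e, neg_neg, intervalIntegral.integral_neg] at h
    linarith
  have hc : Continuous fun t => cos (π * t / r) := by fun_prop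
  have hc' : Continuous fun t => t * cos (π * t / r) := by fun_prop
  calc _ ≤ ∫ t in (-r)..r, (((g (r / 2) + g (-(r / 2))) / 2) * cos (π * t / r) +
        (g (r / 2) - g (-(r / 2))) / r * (t * cos (π * t / r))) :=
        intervalIntegral.integral_mono_on (by linarith)
          (hint.mul_continuousOn hc.continuousOn)
          (((hc.const_mul _).add (hc'.const_mul _)).intervalIntegrable _ _)
          fun t ht => hg.mul_cos_le_affine_mul_cos hr ht
    _ = 0 := by
        rw [intervalIntegral.integral_add ((hc.const_mul _).intervalIntegrable _ _)
          ((hc'.const_mul _).intervalIntegrable _ _), intervalIntegral.integral_const_mul,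
          intervalIntegral.integral_const_mul, hcos, hid]
        simp

lemma ConvexOn.integral_mul_cos_sub_nonpos {m r : ℝ} (hr : 0 < r) {f : ℝ → ℝ}
    (hf : ConvexOn ℝ (Icc (m - r) (m + r)) f)
    (hint : IntervalIntegrable f volume (m - r) (m + r)) :
    ∫ t in (m - r)..(m + r), f t * cos (π * (t - m) / r) ≤ 0 := by
  have hconv : ConvexOn ℝ (Icc (-r) r) fun t => f (m + t) := by
    have := hf.translate_right m
    rwa [show (fun z => m + z) ⁻¹' Icc (m - r) (m + r) = Icc (-r) r by
      ext; simp [sub_eq_add_neg]] at this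
  have hi : IntervalIntegrable (fun t => f (m + t)) volume (-r) r := by
    have := hint.comp_add_left m
    simpa using this
  have key := hconv.integral_mul_cos_nonpos hr hi
  have e := intervalIntegral.integral_comp_add_left (a := -r) (b := r)
    (fun t => f t * cos (π * (t - m) / r)) m
  simp only [add_sub_cancel_left, ← sub_eq_add_neg] at e
  rwa [← e]

lemma ConvexOn.intervalIntegrable {u v : ℝ} (huv : u ≤ v) {f : ℝ → ℝ}
    (hf : ConvexOn ℝ (Icc u v) f) (hpos : ∀ t ∈ Icc u v, 0 ≤ f t) :
    IntervalIntegrable f volume u v := by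
  rw [intervalIntegrable_iff_integrableOn_Ioo_of_le huv]
  have hcont : ContinuousOn f (Ioo u v) := by
    simpa using hf.continuousOn_interior
  refine IntegrableOn.of_bound (by simp) (hcont.aestronglyMeasurable measurableSet_Ioo)
    (max (f u) (f v)) ?_
  filter_upwards [ae_restrict_mem measurableSet_Ioo] with t ht
  have ht' := Ioo_subset_Icc_self ht
  rw [norm_of_nonneg (hpos t ht')]
  exact hf.le_max_of_mem_Icc (left_mem_Icc.2 huv) (right_mem_Icc.2 huv) ht'

lemma ConvexOn.neg_one_pow_mul_integral_mul_cos_nonneg {a : ℝ} (ha : 0 < a) {h : ℝ → ℝ}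
    (hconv : ConvexOn ℝ (Icc (-a) a) h) (hint : IntervalIntegrable h volume (-a) a)
    {N : ℕ} (hN : 0 < N) :
    0 ≤ (-1 : ℝ) ^ N * ∫ t in (-a)..a, h t * cos (π * N * t / a) := by
  have hN' : (0 : ℝ) < N := by exact_mod_cast hN
  set r := a / N with hr_def
  have hr : 0 < r := by positivity
  have har : a = N * r := by rw [hr_def]; field_simp
  let m : ℕ → ℝ := fun k => -a + (2 * k + 1) * r
  let u : ℕ → ℝ := fun k => -a + 2 * k * r
  have hu : ∀ k, u k = m k - r := fun k => by simp only [u, m]; ring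
  have hu' : ∀ k, u (k + 1) = m k + r := fun k => by simp only [u, m]; push_cast; ring
  have hsub : ∀ k < N, Icc (m k - r) (m k + r) ⊆ Icc (-a) a := fun k hk => by
    have : (k : ℝ) + 1 ≤ N := by exact_mod_cast hk
    have hk0 : (0 : ℝ) ≤ k * r := by positivity
    apply Icc_subset_Icc <;> simp only [m] <;> nlinarith
  have hpiece : ∀ k < N, IntervalIntegrable h volume (m k - r) (m k + r) := fun k hk => by
    apply hint.mono_set
    rw [uIcc_of_le (by linarith), uIcc_of_le (by linarith)]
    exact hsub k hk
  have hcos : ∀ k : ℕ, ∀ t, (-1 : ℝ) ^ N * cos (π * N * t / a) =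
      -cos (π * (t - m k) / r) := fun k t => by
    have e : π * (t - m k) / r = π * N * t / a + N * π - π - k * (2 * π) := by
      simp only [m]
      rw [har]
      field_simp
      ring
    rw [e, cos_sub_nat_mul_two_pi, cos_sub_pi, cos_add_nat_mul_pi, neg_neg]
  have hc : Continuous fun t => cos (π * N * t / a) := by fun_prop
  have hsum := intervalIntegral.sum_integral_adjacent_intervals (n := N) (a := u)
    (f := fun t => h t * cos (π * N * t / a)) (μ := volume) fun k hk => by
      rw [hu, hu']
      exact (hpiece k hk).mul_continuousOn hc.continuousOn
  rw [show u 0 = -a by simp [u], show u N = a by simp only [u]; rw [har]; ring] at hsum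
  rw [← hsum, Finset.mul_sum]
  refine Finset.sum_nonneg fun k hk => ?_
  rw [Finset.mem_range] at hk
  rw [← intervalIntegral.integral_const_mul, hu, hu']
  have e : ∀ t, (-1 : ℝ) ^ N * (h t * cos (π * N * t / a)) =
      -(h t * cos (π * (t - m k) / r)) := fun t => by
    rw [mul_left_comm, hcos k t, mul_neg]
  simp_rw [e]
  rw [intervalIntegral.integral_neg, neg_nonneg]
  exact (hconv.subset (hsub k hk) (convex_Icc _ _)).integral_mul_cos_sub_nonpos hr (hpiece k hk)

theorem fourier_coefficients_alternate_sign
    (a : ℝ) (ha : 0 < a) (h : ℝ → ℝ) (h_even : ∀ t, h (-t) = h t)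
    (h_pos : ∀ t ∈ Set.Icc (-a) a, 0 < h t)
    (h_conv : ConvexOn ℝ (Set.Icc (-a) a) h) (n : ℤ) :
    0 ≤ (-1 : ℝ) ^ n * ∫ t in (-a)..a, h t * Real.cos (π * n * t / a) := by
  have hint := h_conv.intervalIntegrable (by linarith) fun t ht => (h_pos t ht).le
  have hnat : ∀ N : ℕ, 0 ≤ (-1 : ℝ) ^ N * ∫ t in (-a)..a, h t * cos (π * N * t / a) := by
    intro N
    rcases N.eq_zero_or_pos with rfl | hN
    · simpa using intervalIntegral.integral_nonneg (by linarith) fun t ht => (h_pos t ht).le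
    · exact h_conv.neg_one_pow_mul_integral_mul_cos_nonneg ha hint hN
  obtain ⟨N, rfl | rfl⟩ := n.eq_nat_or_neg
  · simpa using hnat N
  · have e : ∀ t, cos (π * ((-(N : ℤ) : ℤ) : ℝ) * t / a) = cos (π * N * t / a) := fun t => by
      rw [← cos_neg]; push_cast; congr 1; ring
    simp_rw [e]
    rw [zpow_neg, zpow_natCast, ← inv_pow, inv_neg_one]
    exact hnat N
end
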